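/- Let n ≥ 1 and let f, g ∈ QC₀(ℝⁿ) have compact superlevel sets {f ≥ t} and {g ≥ t} for every t ∈ (0,1]. Then (f ⊕ g)*(x) ≥ (f* ⊕ g*)(x) for every x ∈ ℝⁿ. Consequently, ∫_{ℝⁿ} (f ⊕ g) ≥ ∫_{ℝⁿ} (f* ⊕ g*). -/

import Mathlib

open MeasureTheory ENNReal Filter Topology

noncomputable section

abbrev En (n : ℕ) := EuclideanSpace ℝ (Fin n)

def QuasiConcave {n : ℕ} (f : En n → ℝ≥0∞) : Prop :=
  ∀ x y : En n, ∀ l : ℝ, 0 < l → l < 1 →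
    min (f x) (f y) ≤ f (l • x + (1 - l) • y)

def QC {n : ℕ} (f : En n → ℝ≥0∞) : Prop :=
  UpperSemicontinuous f ∧ QuasiConcave f ∧ ∀ x, f x ≠ ∞

def QC0 {n : ℕ} (f : En n → ℝ≥0∞) : Prop :=
  QC f ∧ f 0 = 1 ∧ ∀ x, f x ≤ 1

def oplus {n : ℕ} (f g : En n → ℝ≥0∞) : En n → ℝ≥0∞ :=
  fun x => ⨆ y : En n, min (f y) (g (x - y))

/-- The symmetric decreasing rearrangement. -/
def fstar {n : ℕ} (f : En n → ℝ≥0∞) : En n → ℝ≥0∞ :=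
  fun x => sSup {t : ℝ≥0∞ | t ≤ 1 ∧
    volume (Metric.closedBall (0 : En n) ‖x‖) ≤ volume {y : En n | t ≤ f y}}

open scoped Pointwise

/-- Layer cake formula for `ℝ≥0∞`-valued functions that do not take the value `∞`. -/
theorem lintegral_eq_lintegral_meas_ofReal_lt {α : Type*} [MeasurableSpace α] {μ : Measure α}
    {f : α → ℝ≥0∞} (hf : AEMeasurable f μ) (hfin : ∀ x, f x ≠ ∞) :
    ∫⁻ x, f x ∂μ = ∫⁻ t in Set.Ioi (0 : ℝ), μ {x | ENNReal.ofReal t < f x} := by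
  have h := lintegral_eq_lintegral_meas_lt (f := fun x => (f x).toReal) μ
    (Eventually.of_forall fun x => ENNReal.toReal_nonneg) hf.ennreal_toReal
  simp only [ENNReal.ofReal_toReal (hfin _)] at h
  rw [h]
  refine setLIntegral_congr_fun measurableSet_Ioi fun t ht => ?_
  simp only [ENNReal.ofReal_lt_iff_lt_toReal (le_of_lt ht) (hfin _)]

theorem volume_add_volume_le_of_isCompact {K L C : Set ℝ} (hK : IsCompact K) (hL : IsCompact L)
    (hK' : K.Nonempty) (hL' : L.Nonempty) (hC : ∀ x ∈ K, ∀ y ∈ L, x + y ∈ C) :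
    volume K + volume L ≤ volume C := by
  obtain ⟨a, ha, ha'⟩ := hK.exists_isGreatest hK'
  obtain ⟨b, hb, hb'⟩ := hL.exists_isLeast hL'
  have h1 : volume ((fun x => x + b) '' K) = volume K := by simp
  have h2 : volume ((fun y => a + y) '' L) = volume L := by simp
  rw [← h1, ← h2, ← measure_union₀]
  · apply measure_mono
    rintro _ (⟨x, hx, rfl⟩ | ⟨y, hy, rfl⟩)
    · exact hC x hx b hb
    · exact hC a ha y hy
  · exact (hL.image (by fun_prop)).measurableSet.nullMeasurableSet
  · refine measure_mono_null (t := {a + b}) ?_ (by simp)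
    rintro _ ⟨⟨x, hx, rfl⟩, ⟨y, hy, hxy⟩⟩
    have := ha' hx
    have := hb' hy
    simp only [Set.mem_singleton_iff] at hxy ⊢
    linarith

/-- The Brunn-Minkowski inequality on the line. -/
theorem volume_add_volume_le {A B C : Set ℝ} (hA : MeasurableSet A) (hB : MeasurableSet B)
    (hA' : A.Nonempty) (hB' : B.Nonempty) (hC : ∀ x ∈ A, ∀ y ∈ B, x + y ∈ C) :
    volume A + volume B ≤ volume C := by
  obtain ⟨a, ha⟩ := hA'
  obtain ⟨b, hb⟩ := hB'
  rw [hA.measure_eq_iSup_isCompact, hB.measure_eq_iSup_isCompact]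
  simp only [iSup_and']
  refine ENNReal.biSup_add_biSup_le' ⟨∅, by simp⟩ ⟨∅, by simp⟩ ?_
  rintro K ⟨hKA, hK⟩ L ⟨hLB, hL⟩
  calc volume K + volume L ≤ volume (insert a K) + volume (insert b L) := by
        gcongr <;> exact Set.subset_insert _ _
    _ ≤ volume C := by
        refine volume_add_volume_le_of_isCompact (hK.insert a) (hL.insert b)
          (Set.insert_nonempty _ _) (Set.insert_nonempty _ _) fun x hx y hy => ?_
        exact hC x (Set.insert_subset ha hKA hx) y (Set.insert_subset hb hLB hy)

theorem volume_weighted_add_le {l m : ℝ} (hl : 0 < l) (hm : 0 < m) {A B C : Set ℝ}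
    (hA : MeasurableSet A) (hB : MeasurableSet B)
    (hA' : A.Nonempty) (hB' : B.Nonempty) (hC : ∀ x ∈ A, ∀ y ∈ B, l * x + m * y ∈ C) :
    ENNReal.ofReal l * volume A + ENNReal.ofReal m * volume B ≤ volume C := by
  have h := volume_add_volume_le (hA.const_smul₀ l) (hB.const_smul₀ m) hA'.smul_set hB'.smul_set
    (C := C) (by
      rintro _ ⟨x, hx, rfl⟩ _ ⟨y, hy, rfl⟩
      exact hC x hx y hy)
  simpa [Measure.addHaar_smul, abs_of_pos hl, abs_of_pos hm] using h

/-- Weighted arithmetic-geometric mean inequality in `ℝ≥0∞`. -/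
theorem rpow_mul_rpow_le_weighted_add {l m : ℝ} (hl : 0 < l) (hm : 0 < m) (hlm : l + m = 1)
    (a b : ℝ≥0∞) : a ^ l * b ^ m ≤ ENNReal.ofReal l * a + ENNReal.ofReal m * b := by
  have hpq : (l⁻¹).HolderConjugate m⁻¹ :=
    Real.holderConjugate_iff.2 ⟨(one_lt_inv₀ hl).2 (by linarith), by simpa using hlm⟩
  have h := ENNReal.young_inequality (a ^ l) (b ^ m) hpq
  rw [← ENNReal.rpow_mul, ← ENNReal.rpow_mul, mul_inv_cancel₀ hl.ne', mul_inv_cancel₀ hm.ne',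
    ENNReal.rpow_one, ENNReal.rpow_one, ENNReal.ofReal_inv_of_pos hl, ENNReal.ofReal_inv_of_pos hm,
    div_eq_mul_inv, div_eq_mul_inv, inv_inv, inv_inv] at h
  rwa [mul_comm _ a, mul_comm _ b]

/-- The Prékopa-Leindler inequality, as a property of a measure space with a linear structure. -/
def PrekopaLeindler (E : Type*) [MeasureSpace E] [AddCommMonoid E] [Module ℝ E] : Prop :=
  ∀ l m : ℝ, 0 < l → 0 < m → l + m = 1 → ∀ f g h : E → ℝ≥0∞,
    Measurable f → Measurable g → Measurable h →
    (∀ x y, f x ^ l * g y ^ m ≤ h (l • x + m • y)) →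
    (∫⁻ x, f x) ^ l * (∫⁻ x, g x) ^ m ≤ ∫⁻ x, h x

theorem weighted_lintegral_add_le {l m : ℝ} (hl : 0 < l) (hm : 0 < m) (hlm : l + m = 1)
    {f g h : ℝ → ℝ≥0∞} (hf : Measurable f) (hg : Measurable g) (hh : Measurable h)
    (hf1 : ∀ x, f x ≤ 1) (hg1 : ∀ x, g x ≤ 1) (hh1 : ∀ x, h x ≤ 1)
    (hf' : ∃ x, f x = 1) (hg' : ∃ x, g x = 1)
    (hfgh : ∀ x y, f x ^ l * g y ^ m ≤ h (l * x + m * y)) :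
    ENNReal.ofReal l * (∫⁻ x, f x) + ENNReal.ofReal m * (∫⁻ x, g x) ≤ ∫⁻ x, h x := by
  rw [lintegral_eq_lintegral_meas_ofReal_lt hf.aemeasurable
      fun x => ((hf1 x).trans_lt one_lt_top).ne,
    lintegral_eq_lintegral_meas_ofReal_lt hg.aemeasurable
      fun x => ((hg1 x).trans_lt one_lt_top).ne,
    lintegral_eq_lintegral_meas_ofReal_lt hh.aemeasurable
      fun x => ((hh1 x).trans_lt one_lt_top).ne,
    ← lintegral_const_mul' _ _ ofReal_ne_top, ← lintegral_const_mul' _ _ ofReal_ne_top]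
  refine (le_lintegral_add _ _).trans (setLIntegral_mono' measurableSet_Ioi fun t ht => ?_)
  obtain ⟨x₀, hx₀⟩ := hf'
  obtain ⟨y₀, hy₀⟩ := hg'
  rcases lt_or_ge t 1 with ht1 | ht1
  · have ht1' : ENNReal.ofReal t < 1 := ENNReal.ofReal_lt_one.2 ht1
    refine volume_weighted_add_le hl hm (measurableSet_lt measurable_const hf)
      (measurableSet_lt measurable_const hg) ⟨x₀, by simpa [hx₀]⟩ ⟨y₀, by simpa [hy₀]⟩
      fun x hx y hy => ?_
    refine lt_of_lt_of_le ?_ (hfgh x y)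
    calc ENNReal.ofReal t = ENNReal.ofReal t ^ l * ENNReal.ofReal t ^ m := by
          rw [← ENNReal.rpow_add_of_nonneg _ _ hl.le hm.le, hlm, ENNReal.rpow_one]
      _ < f x ^ l * g y ^ m :=
          ENNReal.mul_lt_mul (ENNReal.rpow_lt_rpow hx hl) (ENNReal.rpow_lt_rpow hy hm)
  · have ht1' : 1 ≤ ENNReal.ofReal t := ENNReal.one_le_ofReal.2 ht1
    simp [fun x => ((hf1 x).trans ht1').not_gt, fun x => ((hg1 x).trans ht1').not_gt]

theorem lintegral_min_rpow_mul_le {l m : ℝ} (hl : 0 < l) (hm : 0 < m) (hlm : l + m = 1)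
    {f g h : ℝ → ℝ≥0∞} (hf : Measurable f) (hg : Measurable g) (hh : Measurable h)
    {a b : ℝ≥0∞} (ha : a ≠ 0) (ha' : a ≠ ∞) (hb : b ≠ 0) (hb' : b ≠ ∞)
    (hf' : ∃ x, a ≤ f x) (hg' : ∃ x, b ≤ g x)
    (hfgh : ∀ x y, f x ^ l * g y ^ m ≤ h (l * x + m * y)) :
    (∫⁻ x, min (f x) a) ^ l * (∫⁻ x, min (g x) b) ^ m ≤ ∫⁻ x, h x := by
  obtain ⟨x₀, hx₀⟩ := hf'
  obtain ⟨y₀, hy₀⟩ := hg'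
  set c := a ^ l * b ^ m with hc_def
  have hc : c ≠ 0 := by simp [c, ha, hb, ha', hb']
  have hc' : c ≠ ∞ := ENNReal.mul_ne_top (ENNReal.rpow_ne_top_of_nonneg hl.le ha')
    (ENNReal.rpow_ne_top_of_nonneg hm.le hb')
  have key := weighted_lintegral_add_le hl hm hlm
    (f := fun x => a⁻¹ * min (f x) a) (g := fun x => b⁻¹ * min (g x) b)
    (h := fun x => min (c⁻¹ * h x) 1) (by fun_prop) (by fun_prop) (by fun_prop)
    (fun x => (mul_le_mul_right (min_le_right _ _) _).trans (ENNReal.inv_mul_cancel ha ha').le)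
    (fun x => (mul_le_mul_right (min_le_right _ _) _).trans (ENNReal.inv_mul_cancel hb hb').le)
    (fun x => min_le_right _ _)
    ⟨x₀, by rw [min_eq_right hx₀, ENNReal.inv_mul_cancel ha ha']⟩
    ⟨y₀, by rw [min_eq_right hy₀, ENNReal.inv_mul_cancel hb hb']⟩ (by
      intro x y
      rw [ENNReal.mul_rpow_of_nonneg _ _ hl.le, ENNReal.mul_rpow_of_nonneg _ _ hm.le,
        mul_mul_mul_comm, ENNReal.inv_rpow, ENNReal.inv_rpow,
        ← ENNReal.mul_inv (Or.inl (by simp [ha, ha'])) (Or.inr (by simp [hb, hb'])), ← hc_def]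
      refine le_min ?_ ?_
      · gcongr
        refine le_trans ?_ (hfgh x y)
        gcongr <;> exact min_le_left _ _
      · rw [← ENNReal.inv_mul_cancel hc hc']
        gcongr
        rw [hc_def]
        gcongr <;> exact min_le_right _ _)
  rw [lintegral_const_mul' _ _ (ENNReal.inv_ne_top.2 ha),
    lintegral_const_mul' _ _ (ENNReal.inv_ne_top.2 hb)] at key
  have h1 := (rpow_mul_rpow_le_weighted_add hl hm hlm _ _).trans key
  rw [ENNReal.mul_rpow_of_nonneg _ _ hl.le, ENNReal.mul_rpow_of_nonneg _ _ hm.le,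
    mul_mul_mul_comm, ENNReal.inv_rpow, ENNReal.inv_rpow,
    ← ENNReal.mul_inv (Or.inl (by simp [ha, ha'])) (Or.inr (by simp [hb, hb'])), ← hc_def] at h1
  have h2 : ∫⁻ x, min (c⁻¹ * h x) 1 ≤ c⁻¹ * ∫⁻ x, h x := by
    rw [← lintegral_const_mul' _ _ (ENNReal.inv_ne_top.2 hc)]
    exact lintegral_mono fun x => min_le_left _ _
  exact (ENNReal.mul_le_mul_iff_right (ENNReal.inv_ne_zero.2 hc') (ENNReal.inv_ne_top.2 hc)).1
    (h1.trans h2)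

theorem exists_seq_tendsto_lintegral_min {f : ℝ → ℝ≥0∞} (hf : Measurable f)
    (h0 : ∫⁻ x, f x ≠ 0) :
    ∃ u : ℕ → ℝ≥0∞, (∀ k, u k ≠ 0 ∧ u k ≠ ∞ ∧ ∃ x, u k ≤ f x) ∧
      Tendsto (fun k => ∫⁻ x, min (f x) (u k)) atTop (𝓝 (∫⁻ x, f x)) := by
  have hM : 0 < ⨆ x, f x := by
    rw [pos_iff_ne_zero]
    intro hM
    refine h0 ?_
    simp only [iSup_eq_zero] at hM
    simp [hM]
  obtain ⟨u, hu, hu', hlim⟩ := exists_seq_strictMono_tendsto' hM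
  refine ⟨u, fun k => ⟨(hu' k).1.ne', ((hu' k).2.trans_le le_top).ne, ?_⟩, ?_⟩
  · obtain ⟨x, hx⟩ := lt_iSup_iff.1 (hu' k).2
    exact ⟨x, hx.le⟩
  · refine lintegral_tendsto_of_tendsto_of_monotone (fun k => by fun_prop)
      (Eventually.of_forall fun x i j hij => min_le_min le_rfl (hu.monotone hij))
      (Eventually.of_forall fun x => ?_)
    have h := (tendsto_const_nhds (x := f x)).min hlim
    rwa [min_eq_left (le_iSup f x)] at h

theorem PrekopaLeindler.real : PrekopaLeindler ℝ := by
  intro l m hl hm hlm f g h hf hg hh hfgh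
  by_cases h0 : ∫⁻ x, f x = 0
  · simp [h0, hl]
  by_cases h1 : ∫⁻ x, g x = 0
  · simp [h1, hm]
  obtain ⟨u, hu, hu'⟩ := exists_seq_tendsto_lintegral_min hf h0
  obtain ⟨v, hv, hv'⟩ := exists_seq_tendsto_lintegral_min hg h1
  have hlim := ENNReal.Tendsto.mul
    ((ENNReal.continuous_rpow_const (y := l)).tendsto _ |>.comp hu') (Or.inl (by simp [h0, hl.le]))
    ((ENNReal.continuous_rpow_const (y := m)).tendsto _ |>.comp hv') (Or.inl (by simp [h1, hm.le]))
  refine le_of_tendsto' hlim fun k => ?_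
  exact lintegral_min_rpow_mul_le hl hm hlm hf hg hh (hu k).1 (hu k).2.1 (hv k).1 (hv k).2.1
    (hu k).2.2 (hv k).2.2 hfgh

theorem PrekopaLeindler.of_measurePreserving {E F : Type*} [MeasureSpace E] [AddCommMonoid E]
    [Module ℝ E] [MeasureSpace F] [AddCommMonoid F] [Module ℝ F] (hE : PrekopaLeindler E)
    {e : E → F} (he : MeasurePreserving e)
    (he' : ∀ (l m : ℝ) (x y : E), e (l • x + m • y) = l • e x + m • e y) :
    PrekopaLeindler F := by
  intro l m hl hm hlm f g h hf hg hh hfgh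
  rw [← he.lintegral_comp hf, ← he.lintegral_comp hg, ← he.lintegral_comp hh]
  refine hE l m hl hm hlm _ _ _ (hf.comp he.measurable) (hg.comp he.measurable)
    (hh.comp he.measurable) fun x y => ?_
  rw [he']
  exact hfgh _ _

theorem PrekopaLeindler.prod {E F : Type*} [MeasureSpace E] [AddCommMonoid E]
    [Module ℝ E] [MeasureSpace F] [AddCommMonoid F] [Module ℝ F]
    [SFinite (volume : Measure F)]
    (hE : PrekopaLeindler E) (hF : PrekopaLeindler F) : PrekopaLeindler (E × F) := by
  intro l m hl hm hlm f g h hf hg hh hfgh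
  rw [Measure.volume_eq_prod, lintegral_prod _ hf.aemeasurable, lintegral_prod _ hg.aemeasurable,
    lintegral_prod _ hh.aemeasurable]
  refine hE l m hl hm hlm _ _ _ hf.lintegral_prod_right' hg.lintegral_prod_right'
    hh.lintegral_prod_right' fun x y => ?_
  exact hF l m hl hm hlm _ _ _ (hf.comp measurable_prodMk_left) (hg.comp measurable_prodMk_left)
    (hh.comp measurable_prodMk_left) fun z w => hfgh (x, z) (y, w)

theorem PrekopaLeindler.pi (n : ℕ) : PrekopaLeindler (Fin n → ℝ) := by
  induction n with
  | zero =>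
    intro l m hl hm hlm f g h hf hg hh hfgh
    have hv : (volume : Measure (Fin 0 → ℝ)) = Measure.dirac default := by
      rw [volume_pi, Measure.pi_of_empty _ default]
    rw [hv, lintegral_dirac' _ hf, lintegral_dirac' _ hg, lintegral_dirac' _ hh]
    convert hfgh default default
  | succ n ih =>
    refine (PrekopaLeindler.real.prod ih).of_measurePreserving
      (volume_preserving_piFinSuccAbove (fun _ : Fin (n + 1) => ℝ) 0).symm fun l m x y => ?_
    ext i
    refine Fin.cases ?_ (fun j => ?_) i <;>
      simp [MeasurableEquiv.piFinSuccAbove_symm_apply, Fin.insertNthEquiv]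

theorem PrekopaLeindler.euclideanSpace (n : ℕ) : PrekopaLeindler (En n) :=
  (PrekopaLeindler.pi n).of_measurePreserving (PiLp.volume_preserving_toLp (Fin n))
    fun _ _ _ _ => rfl

theorem volume_closedBall_le_iff {n : ℕ} {r : ℝ} (hr : 0 < r) (S : Set (En n)) :
    volume (Metric.closedBall (0 : En n) r) ≤ volume S ↔
      volume (Metric.closedBall (0 : En n) 1) ≤ volume ((r • ·) ⁻¹' S) := by
  have hd : 0 < r ^ Module.finrank ℝ (En n) := pow_pos hr _
  rw [Measure.addHaar_closedBall' _ _ hr.le, Measure.addHaar_preimage_smul _ hr.ne',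
    abs_of_pos (inv_pos.2 hd), ENNReal.ofReal_inv_of_pos hd,
    ENNReal.mul_le_iff_le_inv (by simpa using hd) ofReal_ne_top]

/-- The Brunn-Minkowski inequality, in the form of a comparison with balls. -/
theorem volume_closedBall_add_le {n : ℕ} {r s : ℝ} (hr : 0 ≤ r) (hs : 0 ≤ s) {A B C : Set (En n)}
    (hA : MeasurableSet A) (hB : MeasurableSet B) (hC : MeasurableSet C)
    (hA' : A.Nonempty) (hB' : B.Nonempty) (hABC : ∀ x ∈ A, ∀ y ∈ B, x + y ∈ C)
    (hrA : volume (Metric.closedBall (0 : En n) r) ≤ volume A)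
    (hsB : volume (Metric.closedBall (0 : En n) s) ≤ volume B) :
    volume (Metric.closedBall (0 : En n) (r + s)) ≤ volume C := by
  rcases hr.eq_or_lt with rfl | hr
  · obtain ⟨a, ha⟩ := hA'
    rw [zero_add]
    refine hsB.trans ?_
    rw [← measure_preimage_add volume (-a) B]
    refine measure_mono fun x hx => ?_
    simpa using hABC a ha _ hx
  rcases hs.eq_or_lt with rfl | hs
  · obtain ⟨b, hb⟩ := hB'
    rw [add_zero]
    refine hrA.trans ?_
    rw [← measure_preimage_add_right volume (-b) A]
    refine measure_mono fun x hx => ?_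
    simpa using hABC _ hx b hb
  have hrs : 0 < r + s := add_pos hr hs
  rw [volume_closedBall_le_iff hr] at hrA
  rw [volume_closedBall_le_iff hs] at hsB
  rw [volume_closedBall_le_iff hrs]
  have hmeas : ∀ (t : ℝ) {S : Set (En n)}, MeasurableSet S →
      MeasurableSet ((t • · : En n → En n) ⁻¹' S) := fun t S hS => measurable_const_smul t hS
  have hl : 0 < r / (r + s) := div_pos hr hrs
  have hm : 0 < s / (r + s) := div_pos hs hrs
  have hlm : r / (r + s) + s / (r + s) = 1 := by field_simp
  have key := PrekopaLeindler.euclideanSpace n _ _ hl hm hlm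
    (((r • ·) ⁻¹' A).indicator 1) (((s • ·) ⁻¹' B).indicator 1)
    ((((r + s) • ·) ⁻¹' C).indicator 1)
    (measurable_one.indicator (hmeas r hA)) (measurable_one.indicator (hmeas s hB))
    (measurable_one.indicator (hmeas (r + s) hC)) (by
      intro x y
      by_cases hx : r • x ∈ A
      · by_cases hy : s • y ∈ B
        · have hxy : (r / (r + s)) • x + (s / (r + s)) • y ∈ ((r + s) • ·) ⁻¹' C := by
            rw [Set.mem_preimage, smul_add, smul_smul, smul_smul,
              mul_div_cancel₀ _ hrs.ne',
              mul_div_cancel₀ _ hrs.ne']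
            exact hABC _ hx _ hy
          rw [Set.indicator_of_mem hxy]
          simp [Set.indicator, hx, hy]
        · simp [Set.indicator, hy, hm]
      · simp [Set.indicator, hx, hl])
  rw [lintegral_indicator_one (hmeas r hA), lintegral_indicator_one (hmeas s hB),
    lintegral_indicator_one (hmeas (r + s) hC)] at key
  refine le_trans ?_ key
  calc volume (Metric.closedBall (0 : En n) 1)
      = volume (Metric.closedBall (0 : En n) 1) ^ (r / (r + s)) *
        volume (Metric.closedBall (0 : En n) 1) ^ (s / (r + s)) := by
        rw [← ENNReal.rpow_add_of_nonneg _ _ hl.le hm.le, hlm, ENNReal.rpow_one]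
    _ ≤ _ := by gcongr

theorem le_fstar_oplus_of_lt {n : ℕ} {f g : En n → ℝ≥0∞}
    (hf0 : f 0 = 1) (hg0 : g 0 = 1)
    (hfc : ∀ t : ℝ≥0∞, 0 < t → t ≤ 1 → IsCompact {x : En n | t ≤ f x})
    (hgc : ∀ t : ℝ≥0∞, 0 < t → t ≤ 1 → IsCompact {x : En n | t ≤ g x})
    {x y : En n} {t : ℝ≥0∞} (hft : t < fstar f y) (hgt : t < fstar g x) :
    t ≤ fstar (oplus f g) (y + x) := by
  obtain ⟨u, ⟨hu1, hu⟩, htu⟩ := lt_sSup_iff.1 hft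
  obtain ⟨v, ⟨hv1, hv⟩, htv⟩ := lt_sSup_iff.1 hgt
  rcases eq_zero_or_pos t with rfl | ht
  · exact zero_le
  have ht1 : t ≤ 1 := htu.le.trans hu1
  refine le_sSup ⟨ht1, ?_⟩
  refine (measure_mono (Metric.closedBall_subset_closedBall (norm_add_le y x))).trans ?_
  refine (volume_closedBall_add_le (norm_nonneg _) (norm_nonneg _)
    (hfc t ht ht1).measurableSet (hgc t ht ht1).measurableSet
    (C := {x | t ≤ f x} + {x | t ≤ g x}) ((hfc t ht ht1).add (hgc t ht ht1)).measurableSet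
    ⟨0, by simpa [hf0]⟩ ⟨0, by simpa [hg0]⟩ (fun _ hx _ hy => Set.add_mem_add hx hy)
    (hu.trans (measure_mono fun z hz => htu.le.trans hz))
    (hv.trans (measure_mono fun z hz => htv.le.trans hz))).trans (measure_mono ?_)
  rintro _ ⟨a, ha, b, hb, rfl⟩
  exact le_iSup_of_le (f := fun y => min (f y) (g (a + b - y))) a
    (le_min ha (by simpa using hb))

theorem oplus_fstar_le {n : ℕ} {f g : En n → ℝ≥0∞}
    (hf0 : f 0 = 1) (hg0 : g 0 = 1)
    (hfc : ∀ t : ℝ≥0∞, 0 < t → t ≤ 1 → IsCompact {x : En n | t ≤ f x})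
    (hgc : ∀ t : ℝ≥0∞, 0 < t → t ≤ 1 → IsCompact {x : En n | t ≤ g x}) (x : En n) :
    oplus (fstar f) (fstar g) x ≤ fstar (oplus f g) x := by
  refine iSup_le fun y => le_of_forall_lt_imp_le_of_dense fun t ht => ?_
  obtain ⟨hft, hgt⟩ := lt_min_iff.1 ht
  simpa using le_fstar_oplus_of_lt hf0 hg0 hfc hgc hft hgt

theorem setOf_lt_oplus {n : ℕ} (f g : En n → ℝ≥0∞) (t : ℝ≥0∞) :
    {x | t < oplus f g x} = {x | t < f x} + {x | t < g x} := by
  ext x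
  simp only [oplus, Set.mem_ofPred_eq, lt_iSup_iff, lt_min_iff, Set.mem_add]
  constructor
  · rintro ⟨y, hy, hxy⟩
    exact ⟨y, hy, x - y, hxy, by simp⟩
  · rintro ⟨y, hy, z, hz, rfl⟩
    exact ⟨y, hy, by simpa using hz⟩

theorem QuasiConcave.convex_setOf_lt {n : ℕ} {f : En n → ℝ≥0∞} (hf : QuasiConcave f)
    (t : ℝ≥0∞) : Convex ℝ {x | t < f x} := by
  rw [convex_iff_forall_pos]
  intro x hx y hy a b ha hb hab
  obtain rfl : b = 1 - a := by linarith
  exact (lt_min hx hy).trans_le (hf x y a ha (by linarith))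

theorem QuasiConcave.aemeasurable_oplus {n : ℕ} {f g : En n → ℝ≥0∞} (hf : QuasiConcave f)
    (hg : QuasiConcave g) : AEMeasurable (oplus f g) := by
  refine NullMeasurable.aemeasurable ?_
  refine measurable_of_Ioi (δ := NullMeasurableSpace (En n) volume) fun t => ?_
  have h := ((hf.convex_setOf_lt t).add (hg.convex_setOf_lt t)).nullMeasurableSet volume
  rwa [← setOf_lt_oplus] at h

theorem measurable_fstar {n : ℕ} (f : En n → ℝ≥0∞) : Measurable (fstar f) := by
  have h : Antitone fun r : ℝ => sSup {t : ℝ≥0∞ | t ≤ 1 ∧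
      volume (Metric.closedBall (0 : En n) r) ≤ volume {y : En n | t ≤ f y}} :=
    fun r s hrs => sSup_le_sSup fun t ht =>
      ⟨ht.1, (measure_mono (Metric.closedBall_subset_closedBall hrs)).trans ht.2⟩
  exact h.measurable.comp measurable_norm

theorem fstar_le_one {n : ℕ} (f : En n → ℝ≥0∞) (x : En n) : fstar f x ≤ 1 :=
  sSup_le fun _ ht => ht.1

theorem oplus_le_one {n : ℕ} {f : En n → ℝ≥0∞} (g : En n → ℝ≥0∞) (hf : ∀ x, f x ≤ 1) (x : En n) :
    oplus f g x ≤ 1 :=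
  iSup_le fun y => (min_le_left _ _).trans (hf y)

theorem volume_setOf_volume_closedBall_le {n : ℕ} (hn : n ≠ 0) (V : ℝ≥0∞) :
    volume {x : En n | volume (Metric.closedBall (0 : En n) ‖x‖) ≤ V} ≤ V := by
  rcases eq_or_ne V ∞ with rfl | hV
  · exact le_top
  set ω := volume (Metric.closedBall (0 : En n) 1) with hω_def
  have hω : ω ≠ 0 := (Metric.measure_closedBall_pos volume _ one_pos).ne'
  have hω' : ω ≠ ∞ := measure_closedBall_lt_top.ne
  have hball : ∀ r : ℝ, 0 ≤ r →
      volume (Metric.closedBall (0 : En n) r) = ENNReal.ofReal (r ^ n) * ω := fun r hr => by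
    rw [Measure.addHaar_closedBall' _ _ hr, finrank_euclideanSpace_fin]
  set R := (V / ω).toReal ^ ((n : ℝ)⁻¹) with hR
  have hR0 : 0 ≤ R := by positivity
  have hRn : R ^ n = (V / ω).toReal := Real.rpow_inv_natCast_pow toReal_nonneg hn
  have hVω : V / ω ≠ ∞ := ENNReal.div_ne_top hV hω
  calc volume {x : En n | volume (Metric.closedBall (0 : En n) ‖x‖) ≤ V}
      ≤ volume (Metric.closedBall (0 : En n) R) := by
        refine measure_mono fun x hx => ?_
        rw [Set.mem_ofPred_eq, hball _ (norm_nonneg x), ← ENNReal.le_div_iff_mul_le (Or.inl hω)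
          (Or.inl hω'), ENNReal.ofReal_le_iff_le_toReal hVω, ← hRn] at hx
        simpa using le_of_pow_le_pow_left₀ hn hR0 hx
    _ ≤ V := by
        rw [hball _ hR0, hRn, ENNReal.ofReal_toReal hVω, ENNReal.div_mul_cancel hω hω']

theorem lintegral_fstar_le {n : ℕ} (hn : n ≠ 0) {f : En n → ℝ≥0∞} (hf : AEMeasurable f)
    (hfin : ∀ x, f x ≠ ∞) : ∫⁻ x, fstar f x ≤ ∫⁻ x, f x := by
  rw [lintegral_eq_lintegral_meas_ofReal_lt (measurable_fstar f).aemeasurable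
      fun x => ((fstar_le_one f x).trans_lt one_lt_top).ne,
    lintegral_eq_lintegral_meas_ofReal_lt hf hfin]
  refine lintegral_mono fun t => ?_
  refine le_trans (measure_mono fun x hx => ?_)
    (volume_setOf_volume_closedBall_le hn (volume {x | ENNReal.ofReal t < f x}))
  obtain ⟨u, ⟨-, hu⟩, htu⟩ := lt_sSup_iff.1 (show ENNReal.ofReal t < fstar f x from hx)
  exact hu.trans (measure_mono fun y hy => htu.trans_le hy)

theorem stmt8 (n : ℕ) (hn : 1 ≤ n) (f g : En n → ℝ≥0∞)
    (hf : QC0 f) (hg : QC0 g)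
    (hfc : ∀ t : ℝ≥0∞, 0 < t → t ≤ 1 → IsCompact {x : En n | t ≤ f x})
    (hgc : ∀ t : ℝ≥0∞, 0 < t → t ≤ 1 → IsCompact {x : En n | t ≤ g x}) :
    (∀ x : En n, oplus (fstar f) (fstar g) x ≤ fstar (oplus f g) x) ∧
    (∫⁻ x, oplus (fstar f) (fstar g) x) ≤ ∫⁻ x, oplus f g x := by
  have hle := oplus_fstar_le hf.2.1 hg.2.1 hfc hgc
  refine ⟨hle, (lintegral_mono hle).trans ?_⟩
  exact lintegral_fstar_le (by omega) (hf.1.2.1.aemeasurable_oplus hg.1.2.1)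
    fun x => ((oplus_le_one g hf.2.2 x).trans_lt one_lt_top).ne
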